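/- Let I be a Borel-fixed monomial ideal of R. Then the Eliahou–Kervaire minimal free resolution F_I of R/I admits the structure of a graded-commutative, associative DG algebra; that is, there exists a unitary, associative multiplication on F_I satisfying the DG algebra axioms with respect to its differential. -/

import Mathlib

open Finset MvPolynomial

attribute [local instance] Classical.propDecidable

noncomputable section

variable (K : Type) [Field K] (n : ℕ)

abbrev Rp : Type := MvPolynomial (Fin n) K

/-!  Monomials are represented by their exponent vectors `α : Fin n →₀ ℕ`
(the monomial `x^α`); multiplication of monomials is addition of exponent vectors,
and divisibility is pointwise `≤`. -/

/-- A set of monomials (exponent vectors) is a monomial ideal if it is closed under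
multiplication by arbitrary monomials. -/
def MonomialIdeal (M : Set (Fin n →₀ ℕ)) : Prop :=
  ∀ a ∈ M, ∀ b : Fin n →₀ ℕ, a + b ∈ M

/-- A monomial ideal is Borel-fixed if for every monomial `g` and indices `i < j`,
`g x_j ∈ I` implies `g x_i ∈ I`. -/
def BorelFixed (M : Set (Fin n →₀ ℕ)) : Prop :=
  ∀ (g : Fin n →₀ ℕ) (i j : Fin n), i < j →
    g + Finsupp.single j 1 ∈ M → g + Finsupp.single i 1 ∈ M

/-- `u` is a minimal monomial generator of the monomial ideal `M`. -/
def IsMinGen (M : Set (Fin n →₀ ℕ)) (u : Fin n →₀ ℕ) : Prop :=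
  u ∈ M ∧ ∀ v ∈ M, v ≤ u → v = u

/-- `u` is the beginning of `g`: `u` is a minimal generator, `u` divides `g` (say
`g = u·v`) and `max(u) ≤ min(v)` (interpreted so that the condition is vacuous when
`u = 1` or `v = 1`, matching the conventions `max(1) = 0`, `min(1) = +∞`). -/
def IsBeginning (M : Set (Fin n →₀ ℕ)) (g u : Fin n →₀ ℕ) : Prop :=
  IsMinGen n M u ∧ ∃ v : Fin n →₀ ℕ, g = u + v ∧
    ∀ i ∈ u.support, ∀ j ∈ v.support, i ≤ j

/-- The beginning `b(g)` of a monomial `g ∈ M` (defined by choice; in a Borel-fixed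
monomial ideal it exists and is unique). -/
def bFun (M : Set (Fin n →₀ ℕ)) (g : Fin n →₀ ℕ) : Fin n →₀ ℕ :=
  if h : ∃ u, IsBeginning n M g u then h.choose else g

/-- The basis index set for `(F_I)_{k+1}`: Eliahou–Kervaire symbols
`(m_p; j_1, …, j_k)` with `m_p` a minimal generator and `j_1 < ⋯ < j_k < max(m_p)`. -/
def FIdx (M : Set (Fin n →₀ ℕ)) (k : ℕ) : Type :=
  {p : (Fin n →₀ ℕ) × Finset (Fin n) //
    IsMinGen n M p.1 ∧ p.2.card = k ∧ ∀ j ∈ p.2, ∃ t ∈ p.1.support, j < t}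

/-- The terms of the Eliahou–Kervaire resolution: `(F_I)_0 = R` and `(F_I)_{k+1}` free
on the symbols above. -/
def FImod (M : Set (Fin n →₀ ℕ)) : ℕ → Type
  | 0 => Rp K n
  | k+1 => FIdx n M k →₀ Rp K n

instance (M : Set (Fin n →₀ ℕ)) : (k : ℕ) → AddCommGroup (FImod K n M k)
  | 0 => inferInstanceAs (AddCommGroup (Rp K n))
  | k+1 => inferInstanceAs (AddCommGroup (FIdx n M k →₀ Rp K n))

instance (M : Set (Fin n →₀ ℕ)) : (k : ℕ) → Module (Rp K n) (FImod K n M k)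
  | 0 => inferInstanceAs (Module (Rp K n) (Rp K n))
  | k+1 => inferInstanceAs (Module (Rp K n) (FIdx n M k →₀ Rp K n))

/-- The Eliahou–Kervaire symbol `(u; s)` as a basis element of `(F_I)_{k+1}` if legal,
and `0` otherwise (the standard convention). -/
def fOf (M : Set (Fin n →₀ ℕ)) (k : ℕ) (u : Fin n →₀ ℕ) (s : Finset (Fin n)) :
    FIdx n M k →₀ Rp K n :=
  if h : IsMinGen n M u ∧ s.card = k ∧ ∀ j ∈ s, ∃ t ∈ u.support, j < t then
    Finsupp.single ⟨(u, s), h⟩ 1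
  else 0

/-- The Eliahou–Kervaire differential `d = ∂ - μ`; the augmentation
`(F_I)_1 → R` sends `(m_p)` to the monomial `m_p`. -/
def dFI (M : Set (Fin n →₀ ℕ)) : (k : ℕ) → FImod K n M (k+1) →ₗ[Rp K n] FImod K n M k
  | 0 => Finsupp.lift _ _ _ fun p => monomial p.1.1 (1 : K)
  | k+1 => Finsupp.lift _ _ _ fun p =>
      -- ∂(m_p; j_1, …, j_i) = Σ_q (-1)^q x_{j_q} (m_p; j_1, …, ĵ_q, …, j_i)
      (∑ j ∈ p.1.2.attach,
        (((-1 : Rp K n) ^ ((p.1.2.filter (fun t => t < j.1)).card + 1)) * X j.1) •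
          fOf K n M k p.1.1 (p.1.2.erase j.1))
      -- μ(m_p; j_1, …, j_i) = Σ_q (-1)^q (m_p x_{j_q}/b(m_p x_{j_q}))
      --                                   (b(m_p x_{j_q}); j_1, …, ĵ_q, …, j_i)
      - (∑ j ∈ p.1.2.attach,
        (((-1 : Rp K n) ^ ((p.1.2.filter (fun t => t < j.1)).card + 1)) *
            monomial ((p.1.1 + Finsupp.single j.1 1) -
              bFun n M (p.1.1 + Finsupp.single j.1 1)) (1 : K)) •
          fOf K n M k (bFun n M (p.1.1 + Finsupp.single j.1 1)) (p.1.2.erase j.1))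

open DirectSum

/-- The underlying graded module of the Eliahou–Kervaire resolution `F_I`
(direct sum of its terms). -/
def FITot (M : Set (Fin n →₀ ℕ)) : Type := ⨁ k, FImod K n M k

instance (M : Set (Fin n →₀ ℕ)) : AddCommGroup (FITot K n M) :=
  inferInstanceAs (AddCommGroup (⨁ k, FImod K n M k))
instance (M : Set (Fin n →₀ ℕ)) : Module (Rp K n) (FITot K n M) :=
  inferInstanceAs (Module (Rp K n) (⨁ k, FImod K n M k))

/-- Inclusion of the `k`-th term of `F_I` into the direct sum. -/
def lofF (M : Set (Fin n →₀ ℕ)) (k : ℕ) : FImod K n M k →ₗ[Rp K n] FITot K n M :=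
  DirectSum.lof (Rp K n) ℕ (FImod K n M) k

/-- Auxiliary: the components of the total differential of `F_I`. -/
def dFIcomp (M : Set (Fin n →₀ ℕ)) : (k : ℕ) → FImod K n M k →ₗ[Rp K n] FITot K n M
  | 0 => 0
  | k+1 => (lofF K n M k).comp (dFI K n M k)

/-- The total differential (degree `-1`) of the Eliahou–Kervaire resolution `F_I`. -/
def DFI (M : Set (Fin n →₀ ℕ)) : FITot K n M →ₗ[Rp K n] FITot K n M :=
  DirectSum.toModule _ _ _ (dFIcomp K n M)


section ExtPart

variable {A : Type} [CommRing A] {n : ℕ}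

def epsE (A : Type) [CommRing A] {n : ℕ} (i : Fin n) : ExteriorAlgebra A (Fin n → A) :=
  ExteriorAlgebra.ι A (Pi.single i (1 : A))

def EL (A : Type) [CommRing A] {n : ℕ} (l : List (Fin n)) : ExteriorAlgebra A (Fin n → A) :=
  (l.map (epsE A)).prod

def ES (A : Type) [CommRing A] {n : ℕ} (S : Finset (Fin n)) : ExteriorAlgebra A (Fin n → A) :=
  EL A (S.sort (· ≤ ·))

lemma EL_nil : EL A ([] : List (Fin n)) = 1 := by simp [EL]
lemma EL_cons (a : Fin n) (l : List (Fin n)) : EL A (a :: l) = epsE A a * EL A l := by simp [EL]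
lemma EL_append (l l' : List (Fin n)) : EL A (l ++ l') = EL A l * EL A l' := by simp [EL]

lemma epsE_sq (i : Fin n) : epsE A i * epsE A i = 0 := ExteriorAlgebra.ι_sq_zero _

lemma epsE_swap (i j : Fin n) : epsE A i * epsE A j = - (epsE A j * epsE A i) :=
  eq_neg_of_add_eq_zero_left (ExteriorAlgebra.ι_add_mul_swap _ _)

lemma EL_perm {l l' : List (Fin n)} (h : l.Perm l') : ∃ c : ℤ, EL A l = c • EL A l' := by
  induction h with
  | nil => exact ⟨1, by simp⟩
  | cons x _ ih =>
    obtain ⟨c, hc⟩ := ih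
    exact ⟨c, by rw [EL_cons, EL_cons, hc, mul_smul_comm]⟩
  | swap x y l =>
    refine ⟨-1, ?_⟩
    rw [EL_cons, EL_cons, EL_cons, EL_cons, ← mul_assoc, ← mul_assoc, epsE_swap y x]
    simp
  | trans _ _ ih1 ih2 =>
    obtain ⟨c, hc⟩ := ih1
    obtain ⟨d, hd⟩ := ih2
    exact ⟨c * d, by rw [hc, hd, mul_smul]⟩

lemma eps_mul_EL (i : Fin n) (l : List (Fin n)) :
    epsE A i * EL A l = (-1 : ℤ) ^ l.length • (EL A l * epsE A i) := by
  induction l with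
  | nil => simp [EL_nil]
  | cons a l ih =>
    rw [EL_cons, ← mul_assoc, epsE_swap, neg_mul, mul_assoc, ih, List.length_cons, pow_succ,
      mul_smul_comm, mul_assoc]
    simp

lemma EL_dup {l : List (Fin n)} (h : ¬ l.Nodup) : EL A l = 0 := by
  induction l with
  | nil => simp at h
  | cons a l ih =>
    rw [EL_cons]
    by_cases hl : l.Nodup
    · have ha : a ∈ l := by
        by_contra hc
        exact h (List.nodup_cons.2 ⟨hc, hl⟩)
      obtain ⟨s, t, rfl⟩ := List.append_of_mem ha
      rw [EL_append, EL_cons, ← mul_assoc, eps_mul_EL, smul_mul_assoc, mul_assoc,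
        ← mul_assoc (epsE A a), epsE_sq]
      simp
    · rw [ih hl, mul_zero]

lemma EL_sort {l : List (Fin n)} (h : l.Nodup) : ∃ c : ℤ, EL A l = c • ES A l.toFinset := by
  apply EL_perm
  apply (List.perm_ext_iff_of_nodup h (Finset.sort_nodup _ _)).2
  intro a; simp

lemma ES_empty : ES A (∅ : Finset (Fin n)) = 1 := by simp [ES, EL_nil]

lemma ES_insert_min {S : Finset (Fin n)} {a : Fin n} (h : ∀ s ∈ S, a < s) :
    ES A (insert a S) = epsE A a * ES A S := by
  unfold ES
  rw [← EL_cons]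
  congr 1
  exact Finset.sort_insert _ (fun b hb => (h b hb).le) (fun ha => lt_irrefl _ (h a ha))

lemma ES_insert_max {S : Finset (Fin n)} {a : Fin n} (h : ∀ s ∈ S, s < a) :
    ES A (insert a S) = ES A S * epsE A a := by
  induction S using Finset.induction_on_min with
  | empty => 
    rw [ES_empty, ES_insert_min (by simp), ES_empty]; simp
  | insert b S hb ih =>
    rw [Finset.insert_comm, ES_insert_min, ih, ES_insert_min hb, mul_assoc]
    · intro s hs; exact h s (by simp [hs])
    · intro s hs
      rcases Finset.mem_insert.1 hs with rfl | hs
      · exact h b (by simp)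
      · exact hb s hs

lemma ES_basis (S : Finset (Fin n)) : (Pi.basisFun A (Fin n)).ExteriorAlgebra S = ES A S := by
  rw [ExteriorAlgebra.basis_apply_ofCard (Pi.basisFun A (Fin n)) rfl]
  rw [ExteriorAlgebra.ιMulti_family, ExteriorAlgebra.ιMulti_apply, ES, EL, ← Finset.listMap_orderEmbOfFin_finRange S rfl, List.map_map, ← List.ofFn_eq_map]
  simp [epsE, Function.comp_def]
  rfl

/-- coordinate functional -/
def phiS (A : Type) [CommRing A] {n : ℕ} (S : Finset (Fin n)) :
    ExteriorAlgebra A (Fin n → A) →ₗ[A] A :=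
  (Pi.basisFun A (Fin n)).ExteriorAlgebra.coord S

lemma phiS_ES (S T : Finset (Fin n)) : phiS A S (ES A T) = if T = S then 1 else 0 := by
  rw [← ES_basis, phiS, Module.Basis.coord_apply, Module.Basis.repr_self, Finsupp.single_apply]

/-- Koszul differential -/
def kosz (w : Fin n → A) : ExteriorAlgebra A (Fin n → A) →ₗ[A] ExteriorAlgebra A (Fin n → A) :=
  CliffordAlgebra.contractLeft ((Pi.basisFun A (Fin n)).constr A w)

lemma kosz_eps_mul (w : Fin n → A) (i : Fin n) (x : ExteriorAlgebra A (Fin n → A)) :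
    kosz w (epsE A i * x) = w i • x - epsE A i * kosz w x := by
  unfold kosz epsE
  have := CliffordAlgebra.contractLeft_ι_mul (Q := (0 : QuadraticForm A (Fin n → A)))
    (d := (Pi.basisFun A (Fin n)).constr A w) (Pi.single i 1) x
  rw [← Pi.basisFun_apply, Module.Basis.constr_basis] at this
  rw [← Pi.basisFun_apply]
  exact this

lemma kosz_one (w : Fin n → A) : kosz w 1 = 0 := CliffordAlgebra.contractLeft_one ..

lemma kosz_ES (w : Fin n → A) (S : Finset (Fin n)) :
    kosz w (ES A S) = ∑ j ∈ S, ((-1 : A) ^ (S.filter (fun t => t < j)).card * w j) • ES A (S.erase j) := by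
  induction S using Finset.induction_on_min with
  | empty => simp [ES_empty, kosz_one]
  | insert a S h ih =>
    have ha : a ∉ S := fun ha => lt_irrefl _ (h a ha)
    rw [ES_insert_min h, kosz_eps_mul, ih, Finset.sum_insert ha, Finset.erase_insert ha,
      sub_eq_add_neg, Finset.mul_sum, ← Finset.sum_neg_distrib]
    congr 1
    · have : (insert a S).filter (fun t => t < a) = ∅ := by
        ext t; simp only [Finset.mem_filter, Finset.mem_insert, Finset.notMem_empty, iff_false]
        rintro ⟨rfl | ht, h2⟩
        · exact lt_irrefl _ h2
        · exact lt_asymm h2 (h t ht)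
      rw [this]; simp
    · apply Finset.sum_congr rfl
      intro j hj
      have hja : a ≠ j := fun e => ha (e ▸ hj)
      have h1 : (insert a S).filter (fun t => t < j) = insert a (S.filter (fun t => t < j)) := by
        rw [Finset.filter_insert, if_pos (h j hj)]
      rw [h1, Finset.card_insert_of_notMem (by simp [ha]), Finset.erase_insert_of_ne hja,
        ES_insert_min (fun s hs => h s (Finset.mem_of_mem_erase hs)), pow_succ, mul_smul_comm]
      simp

lemma grade_ES (S : Finset (Fin n)) : ES A S ∈ ⋀[A]^(S.card) (Fin n → A) := by
  induction S using Finset.induction_on_min with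
  | empty => simp [ES_empty]
  | insert a S h ih =>
    have ha : a ∉ S := fun ha => lt_irrefl _ (h a ha)
    rw [ES_insert_min h, Finset.card_insert_of_notMem ha, ExteriorAlgebra.exteriorPower, pow_succ']
    exact Submodule.mul_mem_mul (LinearMap.mem_range_self _ _) ih

lemma ι_comm (v : Fin n → A) (j : ℕ) (y : ExteriorAlgebra A (Fin n → A))
    (hy : y ∈ ⋀[A]^j (Fin n → A)) :
    ExteriorAlgebra.ι A v * y = (-1 : A) ^ j • (y * ExteriorAlgebra.ι A v) := by
  induction hy using Submodule.pow_induction_on_left' with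
  | algebraMap r => simp [Algebra.commutes]
  | add x y i hx hy ihx ihy => rw [mul_add, add_mul, ihx, ihy, smul_add]
  | mem_mul m hm i x hx ih =>
    obtain ⟨w, rfl⟩ := hm
    rw [← mul_assoc, eq_neg_of_add_eq_zero_left (ExteriorAlgebra.ι_add_mul_swap v w), neg_mul,
      mul_assoc, ih, pow_succ, mul_smul_comm, mul_assoc]
    simp

lemma ext_comm (i j : ℕ) (x y : ExteriorAlgebra A (Fin n → A))
    (hx : x ∈ ⋀[A]^i (Fin n → A)) (hy : y ∈ ⋀[A]^j (Fin n → A)) :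
    x * y = (-1 : A) ^ (i * j) • (y * x) := by
  induction hx using Submodule.pow_induction_on_left' with
  | algebraMap r => simp [Algebra.commutes]
  | add x y i hx hy ihx ihy => rw [mul_add, add_mul, ihx, ihy, smul_add]
  | mem_mul m hm i x hx ih =>
    obtain ⟨w, rfl⟩ := hm
    rw [mul_assoc, ih, mul_smul_comm, ← mul_assoc, ι_comm w j y hy, smul_mul_assoc, smul_smul,
      mul_assoc, ← pow_add]
    congr 2; rw [Nat.succ_eq_add_one]; ring

lemma ext_sq (i : ℕ) (hi : Odd i) (x : ExteriorAlgebra A (Fin n → A))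
    (hx : x ∈ ⋀[A]^i (Fin n → A)) : x * x = 0 := by
  rw [← ExteriorAlgebra.ιMulti_span_fixedDegree] at hx
  have hmem : ∀ y ∈ Submodule.span A (Set.range (ExteriorAlgebra.ιMulti A i (M := Fin n → A))),
      y ∈ ⋀[A]^i (Fin n → A) := by
    intro y hy; rwa [← ExteriorAlgebra.ιMulti_span_fixedDegree]
  induction hx using Submodule.span_induction with
  | zero => simp
  | smul a x hx ih => rw [smul_mul_smul_comm, ih, smul_zero]
  | add x y hx hy ihx ihy =>
    rw [add_mul, mul_add, mul_add, ihx, ihy, ext_comm i i x y (hmem _ hx) (hmem _ hy),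
      (hi.mul hi).neg_one_pow]
    simp
  | mem x hx =>
    obtain ⟨v, rfl⟩ := hx
    obtain ⟨k, rfl⟩ := hi
    rw [ExteriorAlgebra.ιMulti_mul_ιMulti]
    apply ExteriorAlgebra.ιMulti_eq_zero_of_not_inj
    intro hinj
    have := @hinj (Fin.castAdd _ 0) (Fin.natAdd _ 0) (by rw [Fin.append_left, Fin.append_right])
    rw [Fin.ext_iff] at this
    simp at this

lemma kosz_leibniz (w : Fin n → A) (i : ℕ) (x y : ExteriorAlgebra A (Fin n → A))
    (hx : x ∈ ⋀[A]^i (Fin n → A)) :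
    kosz w (x * y) = kosz w x * y + (-1 : A) ^ i • (x * kosz w y) := by
  induction hx using Submodule.pow_induction_on_left' with
  | algebraMap r =>
    have : kosz w (algebraMap A _ r) = 0 := CliffordAlgebra.contractLeft_algebraMap ..
    rw [this, ← Algebra.smul_def, ← Algebra.smul_def]; simp
  | add x y i hx hy ihx ihy => rw [map_add, add_mul, add_mul, map_add, ihx, ihy, add_mul, smul_add]; abel
  | mem_mul m hm i x hx ih =>
    obtain ⟨v, rfl⟩ := hm
    have key : ∀ z, kosz w (ExteriorAlgebra.ι A v * z) =
      ((Pi.basisFun A (Fin n)).constr A w v) • z - ExteriorAlgebra.ι A v * kosz w z :=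
      fun z => CliffordAlgebra.contractLeft_ι_mul ..
    rw [mul_assoc, key, key, ih, sub_mul, mul_add, pow_succ, smul_mul_assoc, mul_assoc, mul_smul_comm,
      mul_assoc]
    simp
    abel

end ExtPart

section CoefPart

variable {K : Type} [Field K] {n : ℕ} (M : Set (Fin n →₀ ℕ))

def AA (K : Type) [Field K] {n : ℕ} (M : Set (Fin n →₀ ℕ)) : Type :=
  MvPolynomial (Fin n) (Rp K n) ⧸
    Ideal.span ((fun s => (monomial s (1 : Rp K n) : MvPolynomial (Fin n) (Rp K n))) '' M)

instance : CommRing (AA K M) :=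
  inferInstanceAs (CommRing (MvPolynomial (Fin n) (Rp K n) ⧸
    Ideal.span ((fun s => (monomial s (1 : Rp K n) : MvPolynomial (Fin n) (Rp K n))) '' M)))

instance : Algebra (Rp K n) (AA K M) :=
  inferInstanceAs (Algebra (Rp K n) (MvPolynomial (Fin n) (Rp K n) ⧸
    Ideal.span ((fun s => (monomial s (1 : Rp K n) : MvPolynomial (Fin n) (Rp K n))) '' M)))

def mp (K : Type) [Field K] {n : ℕ} (M : Set (Fin n →₀ ℕ)) (m : Fin n →₀ ℕ) : AA K M :=
  Ideal.Quotient.mk (Ideal.span ((fun s =>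
    (monomial s (1 : Rp K n) : MvPolynomial (Fin n) (Rp K n))) '' M)) (monomial m 1)

def mx (K : Type) [Field K] {n : ℕ} (M : Set (Fin n →₀ ℕ)) (m : Fin n →₀ ℕ) : AA K M :=
  algebraMap (Rp K n) (AA K M) (monomial m 1)

lemma mp_zero : mp K M 0 = 1 := by
  unfold mp
  exact map_one (Ideal.Quotient.mk _)

lemma mp_add (a b : Fin n →₀ ℕ) : mp K M (a + b) = mp K M a * mp K M b := by
  unfold mp
  refine Eq.trans ?_ (map_mul (Ideal.Quotient.mk _) _ _)
  rw [monomial_mul, one_mul]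

lemma mx_zero : mx K M 0 = 1 := map_one (algebraMap (Rp K n) (AA K M))

lemma mx_add (a b : Fin n →₀ ℕ) : mx K M (a + b) = mx K M a * mx K M b := by
  unfold mx
  rw [← map_mul, monomial_mul, one_mul]

lemma mp_mem {m : Fin n →₀ ℕ} (h : m ∈ M) : mp K M m = 0 :=
  Ideal.Quotient.eq_zero_iff_mem.2 (Ideal.subset_span ⟨m, h, rfl⟩)

lemma mp_le (hMI : MonomialIdeal n M) {m m' : Fin n →₀ ℕ} (h : m ∈ M) (h' : m ≤ m') :
    mp K M m' = 0 := by
  obtain ⟨c, rfl⟩ := exists_add_of_le h'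
  exact mp_mem M (hMI m h c)

lemma exists_coef (hMI : MonomialIdeal n M) {m : Fin n →₀ ℕ} (hm : m ∉ M) :
    ∃ f : AA K M →ₗ[Rp K n] Rp K n, ∀ m', f (mp K M m') = if m' = m then 1 else 0 := by
  let J := Ideal.span ((fun s =>
    (monomial s (1 : Rp K n) : MvPolynomial (Fin n) (Rp K n))) '' M)
  have hJ : J.restrictScalars (Rp K n) ≤ LinearMap.ker (lcoeff (Rp K n) m) := by
    intro x hx
    rw [LinearMap.mem_ker, lcoeff_apply]
    by_contra hc
    obtain ⟨s, hs, hsm⟩ := mem_ideal_span_monomial_image.1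
      (show x ∈ J from hx) m (mem_support_iff.2 hc)
    obtain ⟨c, rfl⟩ := exists_add_of_le hsm
    exact hm (hMI s hs c)
  let f : AA K M →ₗ[Rp K n] Rp K n := (Submodule.liftQ (J.restrictScalars (Rp K n)) _ hJ).comp
    (Submodule.Quotient.restrictScalarsEquiv (Rp K n) J).symm.toLinearMap
  refine ⟨f, fun m' => ?_⟩
  have : f (mp K M m') = coeff m (monomial m' (1 : Rp K n)) := rfl
  rw [this, coeff_monomial]

def pre (g : Fin n →₀ ℕ) (i : Fin n) (a : ℕ) : Fin n →₀ ℕ :=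
  g.filter (fun j => j < i) + Finsupp.single i a

def suf (g : Fin n →₀ ℕ) (i : Fin n) (a : ℕ) : Fin n →₀ ℕ :=
  g.filter (fun j => i < j) + Finsupp.single i a

lemma pre_apply (g : Fin n →₀ ℕ) (i : Fin n) (a : ℕ) (j : Fin n) :
    pre g i a j = if j < i then g j else if j = i then a else 0 := by
  unfold pre
  rw [Finsupp.add_apply, Finsupp.filter_apply, Finsupp.single_apply]
  by_cases h1 : j < i
  · simp [h1, h1.ne']
  · simp [h1, eq_comm]

lemma suf_apply (g : Fin n →₀ ℕ) (i : Fin n) (a : ℕ) (j : Fin n) :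
    suf g i a j = if i < j then g j else if j = i then a else 0 := by
  unfold suf
  rw [Finsupp.add_apply, Finsupp.filter_apply, Finsupp.single_apply]
  by_cases h1 : i < j
  · simp [h1, h1.ne]
  · simp [h1, eq_comm]

def DD (K : Type) [Field K] {n : ℕ} (M : Set (Fin n →₀ ℕ)) (i : Fin n) (g : Fin n →₀ ℕ) : AA K M :=
  ∑ a ∈ range (g i), mp K M (pre g i a) * mx K M (suf g i (g i - 1 - a))

lemma DD_zero {i : Fin n} {g : Fin n →₀ ℕ} (h : g i = 0) : DD K M i g = 0 := by
  simp [DD, h]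

/-- multiply by prime-monomials supported below `i` -/
lemma DD_add_lt {i : Fin n} (g h : Fin n →₀ ℕ) (hh : ∀ j ∈ h.support, j < i) :
    DD K M i (g + h) = mp K M h * DD K M i g := by
  have h0 : ∀ j, i ≤ j → h j = 0 := by
    intro j hj; by_contra hc
    exact absurd (hh j (by simpa using hc)) (not_lt.2 hj)
  unfold DD
  rw [Finset.mul_sum]
  have e : (g + h) i = g i := by simp [h0 i le_rfl]
  rw [e]
  apply Finset.sum_congr rfl
  intro a _
  have e1 : pre (g + h) i a = h + pre g i a := by
    ext j
    rw [Finsupp.add_apply, pre_apply, pre_apply, Finsupp.add_apply]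
    have := h0 j
    grind
  have e2 : ∀ a, suf (g + h) i a = suf g i a := by
    intro a; ext j
    rw [suf_apply, suf_apply, Finsupp.add_apply]
    have := h0 j
    grind
  rw [e1, e2, mp_add, mul_assoc]

lemma DD_add_gt {i : Fin n} (g h : Fin n →₀ ℕ) (hh : ∀ j ∈ h.support, i < j) :
    DD K M i (g + h) = mx K M h * DD K M i g := by
  have h0 : ∀ j, j ≤ i → h j = 0 := by
    intro j hj; by_contra hc
    exact absurd (hh j (by simpa using hc)) (not_lt.2 hj)
  unfold DD
  rw [Finset.mul_sum]
  have e : (g + h) i = g i := by simp [h0 i le_rfl]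
  rw [e]
  apply Finset.sum_congr rfl
  intro a _
  have e1 : pre (g + h) i a = pre g i a := by
    ext j
    rw [pre_apply, pre_apply, Finsupp.add_apply]
    have := h0 j
    grind
  have e2 : ∀ a, suf (g + h) i a = h + suf g i a := by
    intro a; ext j
    rw [Finsupp.add_apply, suf_apply, suf_apply, Finsupp.add_apply]
    have := h0 j
    grind
  rw [e1, e2, mx_add]
  ring

/-- the cut monomial -/
def CC (K : Type) [Field K] {n : ℕ} (M : Set (Fin n →₀ ℕ)) (k : ℕ) (g : Fin n →₀ ℕ) : AA K M :=
  mp K M (g.filter (fun j => (j : ℕ) < k)) * mx K M (g.filter (fun j => k ≤ (j : ℕ)))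

lemma DD_add_eq (i : Fin n) (g : Fin n →₀ ℕ) :
    DD K M i (g + Finsupp.single i 1) = mx K M (Finsupp.single i 1) * DD K M i g
      + CC K M (i + 1) g := by
  unfold DD
  have e : ((g + Finsupp.single i 1 : Fin n →₀ ℕ)) i = g i + 1 := by simp
  have e1 : ∀ a, pre (g + Finsupp.single i 1) i a = pre g i a := by
    intro a; ext j
    rw [pre_apply, pre_apply, Finsupp.add_apply, Finsupp.single_apply]
    grind
  have e2 : ∀ a, suf (g + Finsupp.single i 1) i a = suf g i a := by
    intro a; ext j
    rw [suf_apply, suf_apply, Finsupp.add_apply, Finsupp.single_apply]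
    grind
  rw [e, Finset.sum_range_succ, Finset.mul_sum]
  congr 1
  · apply Finset.sum_congr rfl
    intro a ha
    have ha' := Finset.mem_range.1 ha
    rw [e1, e2, show g i + 1 - 1 - a = (g i - 1 - a) + 1 by omega]
    have e3 : suf g i (g i - 1 - a + 1) = Finsupp.single i 1 + suf g i (g i - 1 - a) := by
      ext j
      rw [Finsupp.add_apply, suf_apply, suf_apply, Finsupp.single_apply]
      grind
    rw [e3, mx_add]; ring
  · rw [e1, e2, CC]
    congr 2
    · ext j
      rw [pre_apply, Finsupp.filter_apply]
      have : ((j : ℕ) < i + 1) ↔ (j < i ∨ j = i) := by rw [Fin.lt_def, Fin.ext_iff]; omega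
      grind
    · ext j
      rw [suf_apply, Finsupp.filter_apply]
      have : ((i : ℕ) + 1 ≤ j) ↔ (i < j) := by rw [Fin.lt_def]; omega
      grind

def wv (K : Type) [Field K] {n : ℕ} (M : Set (Fin n →₀ ℕ)) (i : Fin n) : AA K M :=
  mx K M (Finsupp.single i 1) - mp K M (Finsupp.single i 1)

lemma wv_DD (i : Fin n) (g : Fin n →₀ ℕ) :
    wv K M i * DD K M i g = CC K M i g - CC K M (i + 1) g := by
  -- telescoping: terms `T a = mp (pre g i a) * mx (suf g i (g i - a))`
  have key : ∀ a ∈ range (g i), wv K M i * (mp K M (pre g i a) * mx K M (suf g i (g i - 1 - a))) =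
      mp K M (pre g i a) * mx K M (suf g i (g i - a)) -
        mp K M (pre g i (a + 1)) * mx K M (suf g i (g i - (a + 1))) := by
    intro a ha
    have ha' := Finset.mem_range.1 ha
    have e3 : suf g i (g i - a) = Finsupp.single i 1 + suf g i (g i - 1 - a) := by
      ext j
      rw [Finsupp.add_apply, suf_apply, suf_apply, Finsupp.single_apply]
      grind
    have e4 : pre g i (a + 1) = Finsupp.single i 1 + pre g i a := by
      ext j
      rw [Finsupp.add_apply, pre_apply, pre_apply, Finsupp.single_apply]
      grind
    rw [e3, e4, mx_add, mp_add, show g i - (a + 1) = g i - 1 - a by omega, wv]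
    ring
  unfold DD
  rw [Finset.mul_sum, Finset.sum_congr rfl key, Finset.sum_range_sub', CC, CC]
  congr 1
  · congr 2
    · ext j
      rw [pre_apply, Finsupp.filter_apply]
      have : ((j : ℕ) < i) ↔ (j < i) := by rw [Fin.lt_def]
      grind
    · ext j
      rw [suf_apply, Finsupp.filter_apply]
      have : ((i : ℕ) ≤ j) ↔ (i < j ∨ j = i) := by rw [Fin.lt_def, Fin.ext_iff]; omega
      grind
  · congr 2
    · ext j
      rw [pre_apply, Finsupp.filter_apply]
      have : ((j : ℕ) < i + 1) ↔ (j < i ∨ j = i) := by rw [Fin.lt_def, Fin.ext_iff]; omega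
      grind
    · ext j
      rw [suf_apply, Finsupp.filter_apply]
      have : ((i : ℕ) + 1 ≤ j) ↔ (i < j) := by rw [Fin.lt_def]; omega
      grind

lemma sum_wv_DD {k : ℕ} (hk : k ≤ n) {g : Fin n →₀ ℕ} (hg : g ∈ M) :
    ∑ i ∈ univ.filter (fun i : Fin n => k ≤ (i : ℕ)), wv K M i * DD K M i g = CC K M k g := by
  have h1 : ∀ i : Fin n, (if k ≤ (i : ℕ) then wv K M i * DD K M i g else 0) =
      CC K M (max (i : ℕ) k) g - CC K M (max ((i : ℕ) + 1) k) g := by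
    intro i
    split_ifs with h
    · rw [wv_DD, max_eq_left h, max_eq_left (by omega)]
    · rw [max_eq_right (by omega), max_eq_right (by omega), sub_self]
  rw [Finset.sum_filter, Finset.sum_congr rfl (fun i _ => h1 i),
    Fin.sum_univ_eq_sum_range (fun i => CC K M (max i k) g - CC K M (max (i + 1) k) g) n,
    Finset.sum_range_sub' (fun i => CC K M (max i k) g)]
  have : CC K M (max n k) g = 0 := by
    have e : g.filter (fun j : Fin n => (j : ℕ) < max n k) = g := by
      rw [Finsupp.filter_eq_self_iff]
      intro j _
      have := j.2
      omega
    rw [CC, e, mp_mem M hg, zero_mul]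
  rw [this, sub_zero]
  simp

lemma DD_b (hMI : MonomialIdeal n M) {g u : Fin n →₀ ℕ} (h : IsBeginning n M g u) (i : Fin n) :
    DD K M i g = mx K M (g - u) * DD K M i u := by
  obtain ⟨hu, v, rfl, hv⟩ := h
  rw [add_tsub_cancel_left]
  unfold DD
  rw [Finsupp.add_apply, Finset.sum_range_add, Finset.mul_sum]
  have hz : ∑ x ∈ range (v i), mp K M (pre (u + v) i (u i + x)) *
      mx K M (suf (u + v) i (u i + v i - 1 - (u i + x))) = 0 := by
    apply Finset.sum_eq_zero
    intro a ha
    have ha' := Finset.mem_range.1 ha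
    rw [mp_le M hMI hu.1, zero_mul]
    intro j
    rw [pre_apply, Finsupp.add_apply]
    have h2 : u j ≠ 0 → j ≤ i := fun hj => hv j (by simpa using hj) i (by simp; omega)
    split_ifs with h3 h4
    · omega
    · subst h4; omega
    · by_contra hc
      rcases lt_or_eq_of_le (h2 (by omega)) with h | h
      · exact h3 h
      · exact h4 h
  rw [hz, add_zero]
  apply Finset.sum_congr rfl
  intro a ha
  have ha' := Finset.mem_range.1 ha
  have h2 : ∀ j, v j ≠ 0 → i ≤ j := fun j hj => hv i (by simp; omega) j (by simpa using hj)
  have e1 : pre (u + v) i a = pre u i a := by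
    ext j
    rw [pre_apply, pre_apply, Finsupp.add_apply]
    have := h2 j
    grind
  have e2 : suf (u + v) i (u i + v i - 1 - a) = v + suf u i (u i - 1 - a) := by
    ext j
    rw [Finsupp.add_apply, suf_apply, suf_apply, Finsupp.add_apply]
    have := h2 j
    grind
  rw [e1, e2, mx_add]
  ring

lemma exists_beginning (hMI : MonomialIdeal n M) (hB : BorelFixed n M) :
    ∀ (d : ℕ) (g : Fin n →₀ ℕ), g.degree = d → g ∈ M → ∃ u, IsBeginning n M g u := by
  intro d
  induction d with
  | zero =>
    intro g hd hg
    have : g = 0 := (Finsupp.degree_eq_zero_iff g).1 hd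
    subst this
    exact ⟨0, ⟨hg, fun v _ hv => le_antisymm hv (by simp)⟩, 0, by simp, by simp⟩
  | succ d ih =>
    intro g hd hg
    by_cases hmin : IsMinGen n M g
    · exact ⟨g, hmin, 0, by simp, by simp⟩
    · have : ∃ v ∈ M, v ≤ g ∧ v ≠ g := by
        by_contra hc
        push Not at hc
        exact hmin ⟨hg, hc⟩
      obtain ⟨v, hv, hvg, hne⟩ := this
      obtain ⟨c, rfl⟩ := exists_add_of_le hvg
      have hc0 : c ≠ 0 := by rintro rfl; simp at hne
      obtain ⟨j, hj⟩ := Finsupp.ne_iff.1 hc0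
      have hj' : c j ≠ 0 := by simpa using hj
      obtain ⟨c', rfl⟩ : ∃ c', c = Finsupp.single j 1 + c' :=
        exists_add_of_le (by simpa [Finsupp.single_le_iff] using Nat.one_le_iff_ne_zero.2 hj')
      obtain ⟨g', hg'⟩ : ∃ g', g' = v + c' := ⟨_, rfl⟩
      have hgM : g' ∈ M := hg' ▸ hMI v hv c'
      have heq : v + (Finsupp.single j 1 + c') = g' + Finsupp.single j 1 := by
        rw [hg']; abel
      rw [heq] at hd hg ⊢
      clear heq hg'
      obtain ⟨t, ht, htmax⟩ := (g' + Finsupp.single j 1).support.exists_max_image id ⟨j, by simp⟩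
      have hex : ∃ h, g' + Finsupp.single j 1 = h + Finsupp.single t 1 ∧ h ∈ M := by
        by_cases hjt : j = t
        · subst hjt; exact ⟨g', rfl, hgM⟩
        · have hjlt : j < t := lt_of_le_of_ne (htmax j (by simp)) hjt
          have : g' t ≠ 0 := by
            have := Finsupp.mem_support_iff.1 ht
            simpa [Finsupp.single_apply, hjt] using this
          obtain ⟨q, rfl⟩ : ∃ q, g' = q + Finsupp.single t 1 := by
            obtain ⟨q, hq⟩ := exists_add_of_le (show Finsupp.single t 1 ≤ g' by
              simpa [Finsupp.single_le_iff] using Nat.one_le_iff_ne_zero.2 this)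
            exact ⟨q, by rw [hq]; abel⟩
          exact ⟨q + Finsupp.single j 1, by abel, hB q j t hjlt hgM⟩
      obtain ⟨h, hh, hhM⟩ := hex
      rw [hh] at hd ht htmax ⊢
      obtain ⟨u, hu, w, rfl, huw⟩ := ih h (by rw [map_add, Finsupp.degree_single] at hd; omega) hhM
      refine ⟨u, hu, w + Finsupp.single t 1, by abel, ?_⟩
      intro i hi k hk
      have hi' : u i ≠ 0 := by simpa using hi
      have hk' : w k + Finsupp.single t 1 k ≠ 0 := by simpa using hk
      by_cases hkt : k = t
      · subst hkt
        exact htmax i (by simp; omega)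
      · apply huw i hi k
        rw [Finsupp.single_apply, if_neg (fun e => hkt e.symm)] at hk'
        simpa using hk'

lemma bFun_spec (hMI : MonomialIdeal n M) (hB : BorelFixed n M) {g : Fin n →₀ ℕ} (hg : g ∈ M) :
    IsBeginning n M g (bFun n M g) := by
  have h := exists_beginning M hMI hB _ g rfl hg
  unfold bFun
  rw [dif_pos h]
  exact h.choose_spec

end CoefPart

section MainPart

variable {K : Type} [Field K] {n : ℕ} (M : Set (Fin n →₀ ℕ))

abbrev BB (K : Type) [Field K] {n : ℕ} (M : Set (Fin n →₀ ℕ)) : Type :=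
  ExteriorAlgebra (AA K M) (Fin n → AA K M)

def psiL (K : Type) [Field K] {n : ℕ} (M : Set (Fin n →₀ ℕ)) (g : Fin n →₀ ℕ)
    (l : List (Fin n)) : BB K M :=
  ∑ i ∈ univ.filter (fun i => ∀ s ∈ l, s < i), DD K M i g • (EL (AA K M) l * epsE (AA K M) i)

def psi (K : Type) [Field K] {n : ℕ} (M : Set (Fin n →₀ ℕ)) (g : Fin n →₀ ℕ)
    (S : Finset (Fin n)) : BB K M :=
  ∑ i ∈ univ.filter (fun i => ∀ s ∈ S, s < i), DD K M i g • ES (AA K M) (insert i S)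

lemma psi_eq (g : Fin n →₀ ℕ) (S : Finset (Fin n)) :
    psi K M g S = psiL K M g (S.sort (· ≤ ·)) := by
  unfold psi psiL
  have : (univ.filter (fun i => ∀ s ∈ S.sort (· ≤ ·), s < i)) =
    univ.filter (fun i => ∀ s ∈ S, s < i) := by ext i; simp
  rw [this]
  apply Finset.sum_congr rfl
  intro i hi
  rw [ES_insert_max (by simpa using hi), ES]

lemma smul_mx (m : Fin n →₀ ℕ) (x : BB K M) :
    mx K M m • x = (monomial m (1 : K) : Rp K n) • x := by
  rw [mx, algebraMap_smul]

lemma psi_b (hMI : MonomialIdeal n M) (hB : BorelFixed n M) {g : Fin n →₀ ℕ} (hg : g ∈ M)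
    (S : Finset (Fin n)) :
    psi K M g S = (monomial (g - bFun n M g) (1 : K) : Rp K n) • psi K M (bFun n M g) S := by
  rw [← smul_mx]
  unfold psi
  rw [Finset.smul_sum]
  apply Finset.sum_congr rfl
  intro i _
  rw [DD_b M hMI (bFun_spec M hMI hB hg) i, mul_smul]

lemma kosz_psi_aux (u : Fin n →₀ ℕ) (S : Finset (Fin n)) (j : Fin n) (hj : j ∈ S) :
    mx K M (Finsupp.single j 1) • psi K M u (S.erase j) - psi K M (u + Finsupp.single j 1) (S.erase j)
    = (∑ i ∈ univ.filter (fun i => ∀ s ∈ S, s < i),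
        (wv K M j * DD K M i u) • ES (AA K M) (insert i (S.erase j)))
      + (if ∀ s ∈ S.erase j, s < j then (- CC K M (j + 1) u) • ES (AA K M) S else 0) := by
  unfold psi
  rw [Finset.smul_sum, ← Finset.sum_sub_distrib]
  have hterm : ∀ i : Fin n, mx K M (Finsupp.single j 1) • DD K M i u •
      ES (AA K M) (insert i (S.erase j)) - DD K M i (u + Finsupp.single j 1) •
      ES (AA K M) (insert i (S.erase j)) =
      if j < i then (wv K M j * DD K M i u) • ES (AA K M) (insert i (S.erase j))
      else if i = j then (- CC K M (j + 1) u) • ES (AA K M) S else 0 := by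
    intro i
    rw [smul_smul, ← sub_smul]
    split_ifs with h1 h2
    · rw [DD_add_lt M u _ (by
        intro t ht
        have := Finsupp.support_single_subset ht
        rw [Finset.mem_singleton] at this
        exact this ▸ h1), wv, sub_mul]
    · subst h2
      rw [DD_add_eq, Finset.insert_erase hj]
      congr 1
      ring
    · have hlt : i < j := lt_of_le_of_ne (not_lt.1 h1) h2
      rw [DD_add_gt M u _ (by
        intro t ht
        have := Finsupp.support_single_subset ht
        rw [Finset.mem_singleton] at this
        exact this ▸ hlt), sub_self, zero_smul]
  rw [Finset.sum_congr rfl (fun i _ => hterm i)]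
  rw [Finset.sum_filter, Finset.sum_filter]
  have h2 : (if ∀ s ∈ S.erase j, s < j then (- CC K M (j + 1) u) • ES (AA K M) S else 0) =
      ∑ i : Fin n, if i = j then
        (if ∀ s ∈ S.erase j, s < j then (- CC K M (j + 1) u) • ES (AA K M) S else 0) else 0 := by
    simp
  rw [h2, ← Finset.sum_add_distrib]
  apply Finset.sum_congr rfl
  intro i _
  by_cases hij : i = j
  · subst hij
    have : ¬ ∀ s ∈ S, s < i := fun h => lt_irrefl _ (h i hj)
    simp [this]
  · by_cases hji : j < i
    · have : (∀ s ∈ S.erase j, s < i) ↔ ∀ s ∈ S, s < i := by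
        constructor
        · intro h s hs
          by_cases hsj : s = j
          · exact hsj ▸ hji
          · exact h s (Finset.mem_erase.2 ⟨hsj, hs⟩)
        · intro h s hs; exact h s (Finset.mem_of_mem_erase hs)
      rw [if_congr this rfl rfl, if_pos hji, if_neg hij, add_zero]
    · have : ¬ ∀ s ∈ S, s < i := fun h => hji (h j hj)
      simp [this, hji, hij]

lemma kosz_psi {u : Fin n →₀ ℕ} (hu : u ∈ M) (S : Finset (Fin n)) (hS : S.Nonempty) :
    kosz (wv K M) (psi K M u S) = ∑ j ∈ S, (-1 : AA K M) ^ (S.filter (fun t => t < j)).card •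
      (mx K M (Finsupp.single j 1) • psi K M u (S.erase j) -
        psi K M (u + Finsupp.single j 1) (S.erase j)) := by
  have hL : kosz (wv K M) (psi K M u S) =
      (∑ i ∈ univ.filter (fun i => ∀ s ∈ S, s < i), wv K M i * DD K M i u) •
        ((-1 : AA K M) ^ S.card • ES (AA K M) S) +
      ∑ j ∈ S, (-1 : AA K M) ^ (S.filter (fun t => t < j)).card •
      (∑ i ∈ univ.filter (fun i => ∀ s ∈ S, s < i),
        (wv K M j * DD K M i u) • ES (AA K M) (insert i (S.erase j))) := by
    simp_rw [Finset.smul_sum]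
    rw [Finset.sum_comm, Finset.sum_smul, ← Finset.sum_add_distrib, psi, map_sum]
    apply Finset.sum_congr rfl
    intro i hi
    have hi' : ∀ s ∈ S, s < i := by simpa using hi
    have hiS : i ∉ S := fun h => lt_irrefl _ (hi' i h)
    rw [map_smul, kosz_ES, Finset.sum_insert hiS, smul_add, Finset.smul_sum]
    congr 1
    · have : (insert i S).filter (fun t => t < i) = S := by
        ext t; simp only [Finset.mem_filter, Finset.mem_insert]
        constructor
        · rintro ⟨rfl | h, h2⟩
          · exact absurd h2 (lt_irrefl _)
          · exact h
        · intro h; exact ⟨Or.inr h, hi' t h⟩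
      rw [this, Finset.erase_insert hiS, smul_smul, smul_smul]
      congr 1; ring
    · apply Finset.sum_congr rfl
      intro j hj
      have h1 : (insert i S).filter (fun t => t < j) = S.filter (fun t => t < j) := by
        rw [Finset.filter_insert, if_neg (not_lt.2 (hi' j hj).le)]
      rw [h1, Finset.erase_insert_of_ne (fun e : i = j => hiS (e ▸ hj)), smul_smul, smul_smul]
      congr 1; ring
  have hR : ∑ j ∈ S, (-1 : AA K M) ^ (S.filter (fun t => t < j)).card •
      (mx K M (Finsupp.single j 1) • psi K M u (S.erase j) -
        psi K M (u + Finsupp.single j 1) (S.erase j)) =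
      ∑ j ∈ S, ((-1 : AA K M) ^ (S.filter (fun t => t < j)).card •
      (∑ i ∈ univ.filter (fun i => ∀ s ∈ S, s < i),
        (wv K M j * DD K M i u) • ES (AA K M) (insert i (S.erase j))) +
      (-1 : AA K M) ^ (S.filter (fun t => t < j)).card •
      (if ∀ s ∈ S.erase j, s < j then (- CC K M (j + 1) u) • ES (AA K M) S else 0)) := by
    apply Finset.sum_congr rfl
    intro j hj
    rw [kosz_psi_aux M u S j hj, smul_add]
  rw [hL, hR, Finset.sum_add_distrib, add_comm]
  congr 1
  set m := S.max' hS with hm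
  have hmS : m ∈ S := S.max'_mem hS
  symm
  rw [Finset.sum_eq_single m]
  · have hlt : ∀ s ∈ S.erase m, s < m := fun s hs =>
      lt_of_le_of_ne (S.le_max' s (Finset.mem_of_mem_erase hs)) (Finset.ne_of_mem_erase hs)
    have hf : S.filter (fun t => t < m) = S.erase m := by
      ext t
      simp only [Finset.mem_filter, Finset.mem_erase]
      constructor
      · rintro ⟨h1, h2⟩; exact ⟨h2.ne, h1⟩
      · rintro ⟨h1, h2⟩; exact ⟨h2, hlt t (Finset.mem_erase.2 ⟨h1, h2⟩)⟩
    have hset : univ.filter (fun i => ∀ s ∈ S, s < i) =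
        univ.filter (fun i : Fin n => (m : ℕ) + 1 ≤ (i : ℕ)) := by
      ext i
      simp only [Finset.mem_filter, Finset.mem_univ, true_and]
      constructor
      · intro h; exact h m hmS
      · intro h s hs
        exact lt_of_le_of_lt (S.le_max' s hs) (Fin.lt_def.2 h)
    rw [if_pos hlt, hf, hset, sum_wv_DD M (by have := m.2; omega) hu,
      ← Finset.card_erase_add_one hmS, pow_succ, smul_smul, smul_smul]
    congr 1; ring
  · intro j hj hjm
    rw [if_neg, smul_zero]
    intro h
    exact absurd (h m (Finset.mem_erase.2 ⟨hjm.symm, hmS⟩)) (not_lt.2 (S.le_max' j hj))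
  · intro h; exact absurd hmS h

lemma kosz_psi_empty {u : Fin n →₀ ℕ} (hu : u ∈ M) :
    kosz (wv K M) (psi K M u ∅) = algebraMap (Rp K n) (BB K M) (monomial u 1) := by
  have h := sum_wv_DD (K := K) M (Nat.zero_le n) hu
  have h2 : CC K M 0 u = mx K M u := by
    have e1 : u.filter (fun j : Fin n => (j : ℕ) < 0) = 0 := by ext j; simp
    have e2 : u.filter (fun j : Fin n => 0 ≤ (j : ℕ)) = u := by ext j; simp
    rw [CC, e1, e2, mp_zero, one_mul]
  rw [h2] at h
  rw [IsScalarTower.algebraMap_apply (Rp K n) (AA K M) (BB K M), ← mx, ← h, psi, map_sum, map_sum]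
  simp only [Nat.zero_le, Finset.notMem_empty, false_imp_iff, implies_true]
  apply Finset.sum_congr rfl
  intro i _
  rw [map_smul, kosz_ES, Finset.sum_insert (by simp),
    Finset.erase_insert (by simp), ES_empty, Algebra.algebraMap_eq_smul_one]
  have : (insert i (∅ : Finset (Fin n))).filter (fun t => t < i) = ∅ := by
    ext t; simp +contextual
  rw [this]
  simp [smul_smul, mul_comm]

lemma psi_illegal {u : Fin n →₀ ℕ} {s : Finset (Fin n)}
    (h : ¬ ∀ j ∈ s, ∃ t ∈ u.support, j < t) : psi K M u s = 0 := by
  push Not at h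
  obtain ⟨j, hj, hjt⟩ := h
  apply Finset.sum_eq_zero
  intro i hi
  have hi' : ∀ s' ∈ s, s' < i := by simpa using hi
  rw [DD_zero, zero_smul]
  by_contra hc
  exact absurd (hi' j hj) (not_lt.2 (hjt i (by simpa using hc)))

end MainPart

section ThetaPart

variable {K : Type} [Field K] {n : ℕ} (M : Set (Fin n →₀ ℕ))

def ThetaS (K : Type) [Field K] {n : ℕ} (M : Set (Fin n →₀ ℕ)) (k : ℕ) :
    (FIdx n M k →₀ Rp K n) →ₗ[Rp K n] BB K M :=
  Finsupp.lift _ _ _ fun p => (-1 : Rp K n) ^ k • psi K M p.1.1 p.1.2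

def Theta (K : Type) [Field K] {n : ℕ} (M : Set (Fin n →₀ ℕ)) :
    (k : ℕ) → FImod K n M k →ₗ[Rp K n] BB K M
  | 0 => Algebra.linearMap (Rp K n) (BB K M)
  | k+1 => ThetaS K M k

lemma ThetaS_single (k : ℕ) (p : FIdx n M k) (r : Rp K n) :
    ThetaS K M k (Finsupp.single p r) = r • (-1 : Rp K n) ^ k • psi K M p.1.1 p.1.2 := by
  simp [ThetaS, Finsupp.lift_apply]

lemma ThetaS_fOf (k : ℕ) {u : Fin n →₀ ℕ} {s : Finset (Fin n)} (hu : IsMinGen n M u)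
    (hs : s.card = k) : ThetaS K M k (fOf K n M k u s) = (-1 : Rp K n) ^ k • psi K M u s := by
  unfold fOf
  split_ifs with h
  · exact (ThetaS_single M k ⟨(u, s), h⟩ 1).trans (one_smul _ _)
  · rw [map_zero, psi_illegal M (fun h' => h ⟨hu, hs, h'⟩), smul_zero]

lemma psi_mem (hMI : MonomialIdeal n M) (hB : BorelFixed n M) {g : Fin n →₀ ℕ} (hg : g ∈ M)
    (S : Finset (Fin n)) : psi K M g S ∈ LinearMap.range (ThetaS K M S.card) := by
  rw [psi_b M hMI hB hg]
  apply Submodule.smul_mem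
  refine ⟨(-1 : Rp K n) ^ S.card • fOf K n M S.card (bFun n M g) S, ?_⟩
  rw [map_smul, ThetaS_fOf M _ (bFun_spec M hMI hB hg).1 rfl, smul_smul, ← mul_pow]
  simp

lemma psiL_mem (hMI : MonomialIdeal n M) (hB : BorelFixed n M) {g : Fin n →₀ ℕ} (hg : g ∈ M)
    (l : List (Fin n)) : psiL K M g l ∈ LinearMap.range (ThetaS K M l.length) := by
  by_cases hl : l.Nodup
  · obtain ⟨c, hc⟩ := EL_sort (A := AA K M) hl
    have : psiL K M g l = c • psi K M g l.toFinset := by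
      unfold psiL psi
      rw [Finset.smul_sum]
      have hf : (univ.filter (fun i => ∀ s ∈ l.toFinset, s < i)) =
        univ.filter (fun i => ∀ s ∈ l, s < i) := by ext i; simp
      rw [hf]
      apply Finset.sum_congr rfl
      intro i hi
      rw [ES_insert_max (by simpa using hi), hc, smul_mul_assoc, smul_comm]
    rw [this, ← List.toFinset_card_of_nodup hl]
    exact zsmul_mem (psi_mem M hMI hB hg _) c
  · have : psiL K M g l = 0 := by
      unfold psiL
      simp [EL_dup hl]
    rw [this]
    exact zero_mem _

lemma psiL_mul_part1 (hMI : MonomialIdeal n M) (hB : BorelFixed n M) {u v : Fin n →₀ ℕ}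
    (hv : v ∈ M) (l l' : List (Fin n)) (i : Fin n) (hi : ∀ s ∈ l, s < i) :
    ∑ j ∈ univ.filter (fun j => ∀ s ∈ l', s < j), (if i < j then
      (DD K M i u * DD K M j v) • (EL (AA K M) l * epsE (AA K M) i *
        (EL (AA K M) l' * epsE (AA K M) j)) else 0) ∈
      LinearMap.range (ThetaS K M (l.length + l'.length + 1)) := by
  have key : ∑ j ∈ univ.filter (fun j => ∀ s ∈ l', s < j), (if i < j then
      (DD K M i u * DD K M j v) • (EL (AA K M) l * epsE (AA K M) i *
        (EL (AA K M) l' * epsE (AA K M) j)) else 0) =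
      ∑ a ∈ range (u i), mx K M (suf u i (u i - 1 - a)) •
        psiL K M (v + pre u i a) (l ++ [i] ++ l') := by
    rw [← Finset.sum_filter, Finset.filter_filter]
    have hf : (univ.filter (fun j => (∀ s ∈ l', s < j) ∧ i < j)) =
        univ.filter (fun j => ∀ s ∈ l ++ [i] ++ l', s < j) := by
      ext j
      simp only [Finset.mem_filter, Finset.mem_univ, true_and, List.mem_append, List.mem_singleton]
      constructor
      · rintro ⟨h1, h2⟩ s ((h | h) | h)
        · exact (hi s h).trans h2
        · exact h ▸ h2
        · exact h1 s h
      · intro h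
        exact ⟨fun s hs => h s (Or.inr hs), h i (Or.inl (Or.inr rfl))⟩
    rw [hf]
    unfold psiL
    simp_rw [Finset.smul_sum]
    rw [Finset.sum_comm]
    apply Finset.sum_congr rfl
    intro j hj
    have hij : i < j := by
      have := (Finset.mem_filter.1 hj).2 i
      exact this (by simp)
    have hEL : EL (AA K M) l * epsE (AA K M) i * (EL (AA K M) l' * epsE (AA K M) j) =
        EL (AA K M) (l ++ [i] ++ l') * epsE (AA K M) j := by
      rw [EL_append, EL_append, EL_cons, EL_nil, mul_one, mul_assoc, mul_assoc, mul_assoc]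
    rw [hEL]
    nth_rw 1 [DD]
    rw [Finset.sum_mul, Finset.sum_smul]
    apply Finset.sum_congr rfl
    intro a _
    rw [DD_add_lt M v _ (by
      intro t ht
      by_contra hc
      have h1 : ¬ t < i := fun h => hc (h.trans hij)
      have h2 : t ≠ i := fun h => hc (h ▸ hij)
      rw [Finsupp.mem_support_iff, pre_apply, if_neg h1, if_neg h2] at ht
      exact ht rfl), smul_smul]
    congr 1; ring
  rw [key]
  apply Submodule.sum_mem
  intro a _
  rw [smul_mx]
  apply Submodule.smul_mem
  have := psiL_mem (K := K) M hMI hB (hMI v hv (pre u i a)) (l ++ [i] ++ l')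
  have hlen : (l ++ [i] ++ l').length = l.length + l'.length + 1 := by simp; omega
  rwa [hlen] at this

lemma psiL_mul_part2 (hMI : MonomialIdeal n M) (hB : BorelFixed n M) {u v : Fin n →₀ ℕ}
    (hu : u ∈ M) (l l' : List (Fin n)) (j : Fin n) (hj : ∀ s ∈ l', s < j) :
    ∑ i ∈ univ.filter (fun i => ∀ s ∈ l, s < i), (if j < i then
      (DD K M i u * DD K M j v) • (EL (AA K M) l * epsE (AA K M) i *
        (EL (AA K M) l' * epsE (AA K M) j)) else 0) ∈
      LinearMap.range (ThetaS K M (l.length + l'.length + 1)) := by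
  have key : ∑ i ∈ univ.filter (fun i => ∀ s ∈ l, s < i), (if j < i then
      (DD K M i u * DD K M j v) • (EL (AA K M) l * epsE (AA K M) i *
        (EL (AA K M) l' * epsE (AA K M) j)) else 0) =
      ∑ a ∈ range (v j), mx K M (suf v j (v j - 1 - a)) •
        ((-1 : ℤ) ^ (l' ++ [j]).length • psiL K M (u + pre v j a) (l ++ (l' ++ [j]))) := by
    rw [← Finset.sum_filter, Finset.filter_filter]
    have hf : (univ.filter (fun i => (∀ s ∈ l, s < i) ∧ j < i)) =
        univ.filter (fun i => ∀ s ∈ l ++ (l' ++ [j]), s < i) := by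
      ext i
      simp only [Finset.mem_filter, Finset.mem_univ, true_and, List.mem_append, List.mem_singleton]
      constructor
      · rintro ⟨h1, h2⟩ s (h | h | h)
        · exact h1 s h
        · exact (hj s h).trans h2
        · exact h ▸ h2
      · intro h
        exact ⟨fun s hs => h s (Or.inl hs), h j (Or.inr (Or.inr rfl))⟩
    rw [hf]
    unfold psiL
    simp_rw [Finset.smul_sum]
    rw [Finset.sum_comm]
    apply Finset.sum_congr rfl
    intro i hi
    have hij : j < i := by
      have := (Finset.mem_filter.1 hi).2 j
      exact this (by simp)
    have hEL : EL (AA K M) l * epsE (AA K M) i * (EL (AA K M) l' * epsE (AA K M) j) =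
        (-1 : ℤ) ^ (l' ++ [j]).length • (EL (AA K M) (l ++ (l' ++ [j])) * epsE (AA K M) i) := by
      have : EL (AA K M) l' * epsE (AA K M) j = EL (AA K M) (l' ++ [j]) := by
        rw [EL_append, EL_cons, EL_nil, mul_one]
      rw [this, mul_assoc, eps_mul_EL, mul_smul_comm, EL_append l, mul_assoc]
    rw [hEL]
    nth_rw 2 [DD]
    rw [Finset.mul_sum, Finset.sum_smul]
    apply Finset.sum_congr rfl
    intro a _
    rw [DD_add_lt M u _ (by
      intro t ht
      by_contra hc
      have h1 : ¬ t < j := fun h => hc (h.trans hij)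
      have h2 : t ≠ j := fun h => hc (h ▸ hij)
      rw [Finsupp.mem_support_iff, pre_apply, if_neg h1, if_neg h2] at ht
      exact ht rfl), smul_comm (mx K M _) ((-1 : ℤ) ^ _), smul_smul, smul_comm _ ((-1 : ℤ) ^ _)]
    congr 2; ring
  rw [key]
  apply Submodule.sum_mem
  intro a _
  rw [smul_mx]
  apply Submodule.smul_mem
  have := psiL_mem (K := K) M hMI hB (hMI u hu (pre v j a)) (l ++ (l' ++ [j]))
  have hlen : (l ++ (l' ++ [j])).length = l.length + l'.length + 1 := by simp; omega
  rw [hlen] at this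
  exact zsmul_mem this _

lemma psiL_mul (hMI : MonomialIdeal n M) (hB : BorelFixed n M) {u v : Fin n →₀ ℕ}
    (hu : u ∈ M) (hv : v ∈ M) (l l' : List (Fin n)) :
    psiL K M u l * psiL K M v l' ∈ LinearMap.range (ThetaS K M (l.length + l'.length + 1)) := by
  set G : Fin n → Fin n → BB K M := fun i j => (DD K M i u * DD K M j v) •
    (EL (AA K M) l * epsE (AA K M) i * (EL (AA K M) l' * epsE (AA K M) j)) with hG
  have h0 : ∀ i, G i i = 0 := by
    intro i
    simp only [hG]
    have : EL (AA K M) l * epsE (AA K M) i * (EL (AA K M) l' * epsE (AA K M) i) =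
        EL (AA K M) (l ++ [i] ++ l' ++ [i]) := by
      rw [EL_append, EL_append, EL_append, EL_cons, EL_nil, mul_one, mul_assoc, mul_assoc, mul_assoc]
    rw [this, EL_dup, smul_zero]
    intro h
    rw [List.nodup_append] at h
    exact h.2.2 i (by simp) i (by simp) rfl
  have hsplit : ∀ i j, G i j = (if i < j then G i j else 0) + (if j < i then G i j else 0) := by
    intro i j
    rcases lt_trichotomy i j with h | h | h
    · rw [if_pos h, if_neg h.not_gt, add_zero]
    · subst h; simp [h0]
    · rw [if_pos h, if_neg h.not_gt, zero_add]
  have hexp : psiL K M u l * psiL K M v l' =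
      ∑ i ∈ univ.filter (fun i => ∀ s ∈ l, s < i), ∑ j ∈ univ.filter (fun j => ∀ s ∈ l', s < j),
        G i j := by
    unfold psiL
    rw [Finset.sum_mul_sum]
    apply Finset.sum_congr rfl; intro i _
    apply Finset.sum_congr rfl; intro j _
    rw [smul_mul_smul_comm]
  rw [hexp]
  have hexp2 : ∑ i ∈ univ.filter (fun i => ∀ s ∈ l, s < i),
      ∑ j ∈ univ.filter (fun j => ∀ s ∈ l', s < j), G i j =
      (∑ i ∈ univ.filter (fun i => ∀ s ∈ l, s < i),
        ∑ j ∈ univ.filter (fun j => ∀ s ∈ l', s < j), if i < j then G i j else 0) +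
      ∑ i ∈ univ.filter (fun i => ∀ s ∈ l, s < i),
        ∑ j ∈ univ.filter (fun j => ∀ s ∈ l', s < j), if j < i then G i j else 0 := by
    rw [← Finset.sum_add_distrib]
    apply Finset.sum_congr rfl; intro i _
    rw [← Finset.sum_add_distrib]
    exact Finset.sum_congr rfl (fun j _ => hsplit i j)
  rw [hexp2]
  apply add_mem
  · apply Submodule.sum_mem
    intro i hi
    exact psiL_mul_part1 M hMI hB hv l l' i (by simpa using hi)
  · rw [Finset.sum_comm]
    apply Submodule.sum_mem
    intro j hj
    exact psiL_mul_part2 M hMI hB hu l l' j (by simpa using hj)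

lemma psi_mul (hMI : MonomialIdeal n M) (hB : BorelFixed n M) {u v : Fin n →₀ ℕ}
    (hu : u ∈ M) (hv : v ∈ M) (S T : Finset (Fin n)) :
    psi K M u S * psi K M v T ∈ LinearMap.range (ThetaS K M (S.card + T.card + 1)) := by
  have := psiL_mul (K := K) M hMI hB hu hv (S.sort (· ≤ ·)) (T.sort (· ≤ ·))
  rwa [← psi_eq, ← psi_eq, Finset.length_sort, Finset.length_sort] at this

lemma ThetaS_mul (hMI : MonomialIdeal n M) (hB : BorelFixed n M) (i j : ℕ)
    (x : FIdx n M i →₀ Rp K n) (y : FIdx n M j →₀ Rp K n) :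
    ThetaS K M i x * ThetaS K M j y ∈ LinearMap.range (ThetaS K M (i + j + 1)) := by
  induction x using Finsupp.induction_linear with
  | zero => simp
  | add x x' hx hx' => rw [map_add, add_mul]; exact add_mem hx hx'
  | single p r =>
    induction y using Finsupp.induction_linear with
    | zero => simp
    | add x x' hx hx' => rw [map_add, mul_add]; exact add_mem hx hx'
    | single q s =>
      rw [ThetaS_single, ThetaS_single, smul_mul_assoc, smul_mul_assoc, mul_smul_comm,
        mul_smul_comm]
      apply Submodule.smul_mem
      apply Submodule.smul_mem
      apply Submodule.smul_mem
      apply Submodule.smul_mem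
      have := psi_mul (K := K) M hMI hB p.2.1.1 q.2.1.1 p.1.2 q.1.2
      rwa [p.2.2.1, q.2.2.1] at this

lemma Theta_mul (hMI : MonomialIdeal n M) (hB : BorelFixed n M) (i j : ℕ)
    (x : FImod K n M i) (y : FImod K n M j) :
    ∃ z : FImod K n M (i + j), Theta K M (i + j) z = Theta K M i x * Theta K M j y := by
  obtain ⟨k, hk⟩ : ∃ k, k = i + j := ⟨_, rfl⟩
  rw [← hk]
  match i, j, x, y with
  | 0, j, x, y =>
    obtain rfl : k = j := by omega
    refine ⟨(show Rp K n from x) • y, ?_⟩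
    rw [map_smul, Algebra.smul_def]; rfl
  | i, 0, x, y =>
    obtain rfl : k = i := by omega
    refine ⟨(show Rp K n from y) • x, ?_⟩
    rw [map_smul, Algebra.smul_def, Algebra.commutes]; rfl
  | i+1, j+1, x, y =>
    obtain rfl : k = (i + j + 1) + 1 := by omega
    exact ThetaS_mul M hMI hB i j x y

lemma ThetaS_grade (k : ℕ) (x : FIdx n M k →₀ Rp K n) :
    ThetaS K M k x ∈ ⋀[AA K M]^(k + 1) (Fin n → AA K M) := by
  induction x using Finsupp.induction_linear with
  | zero => simp
  | add x x' hx hx' => rw [map_add]; exact add_mem hx hx'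
  | single p r =>
    rw [ThetaS_single]
    rw [smul_smul, ← algebraMap_smul (AA K M)]
    apply Submodule.smul_mem
    apply Submodule.sum_mem
    intro i hi
    apply Submodule.smul_mem
    have hi' : ∀ s ∈ p.1.2, s < i := by simpa using hi
    have := grade_ES (A := AA K M) (insert i p.1.2)
    rwa [Finset.card_insert_of_notMem (fun h => lt_irrefl _ (hi' i h)), p.2.2.1] at this

lemma Theta_grade (k : ℕ) (x : FImod K n M k) :
    Theta K M k x ∈ ⋀[AA K M]^k (Fin n → AA K M) := by
  match k, x with
  | 0, x =>
    change algebraMap (Rp K n) (BB K M) (show Rp K n from x) ∈ _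
    generalize (show Rp K n from x) = r
    rw [IsScalarTower.algebraMap_apply (Rp K n) (AA K M) (BB K M)]
    rw [ExteriorAlgebra.exteriorPower, pow_zero, Submodule.mem_one]
    exact ⟨_, rfl⟩
  | k+1, x => exact ThetaS_grade M k x

end ThetaPart

section ChainPart

variable {K : Type} [Field K] {n : ℕ} (M : Set (Fin n →₀ ℕ))

lemma neg_smul_AA (c : ℕ) (z : BB K M) : (-1 : AA K M) ^ c • z = (-1 : Rp K n) ^ c • z := by
  rw [← algebraMap_smul (AA K M) ((-1 : Rp K n) ^ c), map_pow, map_neg, map_one]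

lemma kosz_smul_R (r : Rp K n) (z : BB K M) :
    kosz (wv K M) (r • z) = r • kosz (wv K M) z := by
  rw [← algebraMap_smul (AA K M), map_smul, algebraMap_smul]

lemma ThetaS_d_zero (x : FIdx n M 0 →₀ Rp K n) :
    algebraMap (Rp K n) (BB K M) (Finsupp.lift (Rp K n) (Rp K n) _
      (fun p : FIdx n M 0 => monomial p.1.1 (1 : K)) x) = kosz (wv K M) (ThetaS K M 0 x) := by
  induction x using Finsupp.induction_linear with
  | zero => simp
  | add x x' hx hx' => rw [map_add, map_add, map_add, map_add, hx, hx']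
  | single p r =>
    rw [ThetaS_single, pow_zero, one_smul, kosz_smul_R]
    have hp : p.1.2 = ∅ := Finset.card_eq_zero.1 p.2.2.1
    rw [hp, kosz_psi_empty M p.2.1.1, Finsupp.lift_apply, Finsupp.sum_single_index (by simp),
      smul_eq_mul, map_mul, Algebra.smul_def]

def dS (K : Type) [Field K] {n : ℕ} (M : Set (Fin n →₀ ℕ)) (k : ℕ) (p : FIdx n M (k + 1)) :
    FIdx n M k →₀ Rp K n :=
      (∑ j ∈ p.1.2.attach,
        (((-1 : Rp K n) ^ ((p.1.2.filter (fun t => t < j.1)).card + 1)) * X j.1) •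
          fOf K n M k p.1.1 (p.1.2.erase j.1))
      - (∑ j ∈ p.1.2.attach,
        (((-1 : Rp K n) ^ ((p.1.2.filter (fun t => t < j.1)).card + 1)) *
            monomial ((p.1.1 + Finsupp.single j.1 1) -
              bFun n M (p.1.1 + Finsupp.single j.1 1)) (1 : K)) •
          fOf K n M k (bFun n M (p.1.1 + Finsupp.single j.1 1)) (p.1.2.erase j.1))

lemma ThetaS_dS (hMI : MonomialIdeal n M) (hB : BorelFixed n M) (k : ℕ) (p : FIdx n M (k + 1)) :
    ThetaS K M k (dS K M k p) = (-1 : Rp K n) ^ (k + 1) • kosz (wv K M) (psi K M p.1.1 p.1.2) := by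
  have hu := p.2.1
  have hc := p.2.2.1
  unfold dS
  generalize hgu : p.1.1 = u at *
  generalize hgS : p.1.2 = S at *
  have hne : S.Nonempty := by rw [← Finset.card_pos]; omega
  rw [kosz_psi M hu.1 S hne, ← Finset.sum_sub_distrib, map_sum, Finset.smul_sum]
  rw [← Finset.sum_attach S]
  apply Finset.sum_congr rfl
  rintro ⟨j, hj⟩ _
  have hcard : (S.erase j).card = k := by rw [Finset.card_erase_of_mem hj]; omega
  have hM : u + Finsupp.single j 1 ∈ M := hMI u hu.1 _
  rw [map_sub, map_smul, map_smul, ThetaS_fOf M k hu hcard,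
    ThetaS_fOf M k (bFun_spec M hMI hB hM).1 hcard, psi_b M hMI hB hM, smul_mx, neg_smul_AA,
    smul_sub, smul_sub]
  simp only [smul_smul]
  congr 2
  · rw [show (monomial (Finsupp.single j 1) (1 : K)) = (X j : Rp K n) from rfl]
    ring
  · ring

lemma ThetaS_d_succ (hMI : MonomialIdeal n M) (hB : BorelFixed n M) (k : ℕ)
    (x : FIdx n M (k + 1) →₀ Rp K n) :
    ThetaS K M k (Finsupp.lift (FIdx n M k →₀ Rp K n) (Rp K n) _ (dS K M k) x) =
      kosz (wv K M) (ThetaS K M (k + 1) x) := by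
  induction x using Finsupp.induction_linear with
  | zero => simp
  | add x x' hx hx' => rw [map_add, map_add, map_add, map_add, hx, hx']
  | single p r =>
    rw [ThetaS_single, kosz_smul_R, kosz_smul_R, Finsupp.lift_apply,
      Finsupp.sum_single_index (by simp), map_smul, ThetaS_dS M hMI hB]

lemma Theta_d (hMI : MonomialIdeal n M) (hB : BorelFixed n M) (k : ℕ)
    (x : FImod K n M (k + 1)) :
    Theta K M k (dFI K n M k x) = kosz (wv K M) (Theta K M (k + 1) x) := by
  match k, x with
  | 0, x => exact ThetaS_d_zero M x
  | k+1, x => exact ThetaS_d_succ M hMI hB k x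

lemma phi_psi (S T : Finset (Fin n)) (v : Fin n →₀ ℕ) : phiS (AA K M) S (psi K M v T) =
    ∑ i ∈ univ.filter (fun i => ∀ s ∈ T, s < i), if insert i T = S then DD K M i v else 0 := by
  unfold psi
  rw [map_sum]
  apply Finset.sum_congr rfl
  intro i _
  rw [map_smul, phiS_ES, smul_eq_mul, mul_ite, mul_one, mul_zero]

lemma phi_psi_card {S T : Finset (Fin n)} (h : S.card ≠ T.card + 1) (v : Fin n →₀ ℕ) :
    phiS (AA K M) S (psi K M v T) = 0 := by
  rw [phi_psi]
  apply Finset.sum_eq_zero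
  intro i hi
  rw [if_neg]
  rintro rfl
  have hi' : ∀ s ∈ T, s < i := by simpa using hi
  exact h (Finset.card_insert_of_notMem (fun hh => lt_irrefl _ (hi' i hh)))

lemma insert_inj_max {T N : Finset (Fin n)} {i t : Fin n} (hi : ∀ s ∈ T, s < i)
    (ht : ∀ s ∈ N, s < t) (h : insert i T = insert t N) : i = t ∧ T = N := by
  have h1 : i ≤ t := by
    have : i ∈ insert t N := h ▸ Finset.mem_insert_self i T
    rcases Finset.mem_insert.1 this with h | h
    · exact h.le
    · exact (ht i h).le
  have h2 : t ≤ i := by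
    have : t ∈ insert i T := h ▸ Finset.mem_insert_self t N
    rcases Finset.mem_insert.1 this with h | h
    · exact h.le
    · exact (hi t h).le
  have e := le_antisymm h1 h2
  subst e
  refine ⟨rfl, ?_⟩
  rw [← Finset.erase_insert (s := T) (a := i) (fun hh => lt_irrefl _ (hi i hh)), h,
    Finset.erase_insert (fun hh => lt_irrefl _ (ht i hh))]

lemma phi_psi_max {T N : Finset (Fin n)} {t : Fin n} (ht : ∀ s ∈ N, s < t) (v : Fin n →₀ ℕ) :
    phiS (AA K M) (insert t N) (psi K M v T) = if T = N then DD K M t v else 0 := by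
  rw [phi_psi]
  split_ifs with h
  · subst h
    rw [Finset.sum_eq_single t]
    · simp
    · intro i hi hit
      have hi' : ∀ s ∈ T, s < i := by simpa using hi
      rw [if_neg (fun hh => hit (insert_inj_max hi' ht hh).1)]
    · intro hh; exact absurd (by simpa using ht) hh
  · apply Finset.sum_eq_zero
    intro i hi
    have hi' : ∀ s ∈ T, s < i := by simpa using hi
    rw [if_neg (fun hh => h (insert_inj_max hi' ht hh).2)]

lemma pre_add_suf {v : Fin n →₀ ℕ} {i : Fin n} {a : ℕ} (ha : a < v i) :
    pre v i a + suf v i (v i - 1 - a) + Finsupp.single i 1 = v := by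
  ext j
  rw [Finsupp.add_apply, Finsupp.add_apply, pre_apply, suf_apply, Finsupp.single_apply]
  rcases lt_trichotomy j i with h | h | h
  · simp [h, h.not_gt, h.ne, h.ne']
  · subst h; simp; omega
  · simp [h, h.not_gt, h.ne, h.ne']

lemma f_DD (f : AA K M →ₗ[Rp K n] Rp K n) {m : Fin n →₀ ℕ}
    (hf : ∀ m', f (mp K M m') = if m' = m then 1 else 0) (i : Fin n) (v : Fin n →₀ ℕ) :
    f (DD K M i v) = ∑ a ∈ range (v i), if pre v i a = m then
      monomial (suf v i (v i - 1 - a)) (1 : K) else 0 := by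
  unfold DD
  rw [map_sum]
  apply Finset.sum_congr rfl
  intro a _
  rw [mul_comm, mx, ← Algebra.smul_def, map_smul, hf, smul_eq_mul, mul_ite, mul_one, mul_zero]

lemma f_DD_other (f : AA K M →ₗ[Rp K n] Rp K n) {u v : Fin n →₀ ℕ} {t : Fin n} (hut : u t ≠ 0)
    (hf : ∀ m', f (mp K M m') = if m' = u - Finsupp.single t 1 then 1 else 0)
    (hd : v.degree ≤ u.degree) (hne : v ≠ u) : f (DD K M t v) = 0 := by
  rw [f_DD M f hf]
  apply Finset.sum_eq_zero
  intro a ha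
  rw [if_neg]
  intro h
  have h1 := pre_add_suf (Finset.mem_range.1 ha)
  have h2 : u - Finsupp.single t 1 + Finsupp.single t 1 = u := by
    apply tsub_add_cancel_of_le
    rw [Finsupp.single_le_iff]; omega
  rw [h, add_right_comm, h2] at h1
  have h3 : (suf v t (v t - 1 - a)).degree = 0 := by
    have := congrArg Finsupp.degree h1
    rw [map_add] at this
    omega
  rw [(Finsupp.degree_eq_zero_iff _).1 h3, add_zero] at h1
  exact hne h1.symm

lemma f_DD_self (f : AA K M →ₗ[Rp K n] Rp K n) {u : Fin n →₀ ℕ} {t : Fin n} (hut : u t ≠ 0)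
    (hmax : ∀ j ∈ u.support, j ≤ t)
    (hf : ∀ m', f (mp K M m') = if m' = u - Finsupp.single t 1 then 1 else 0) :
    f (DD K M t u) = 1 := by
  rw [f_DD M f hf, Finset.sum_eq_single (u t - 1)]
  · have h0 : suf u t (u t - 1 - (u t - 1)) = 0 := by
      ext j
      rw [suf_apply, Nat.sub_self]
      split_ifs with h1 h2
      · by_contra hc
        exact absurd h1 (not_lt.2 (hmax j (by simpa using hc)))
      · rfl
      · rfl
    have h1 := pre_add_suf (v := u) (i := t) (a := u t - 1) (by omega)
    rw [h0, add_zero] at h1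
    rw [if_pos, h0]
    · rfl
    · exact eq_tsub_of_add_eq h1
  · intro a ha hau
    rw [if_neg]
    intro h
    have := DFunLike.congr_fun h t
    rw [pre_apply] at this
    simp at this
    exact hau this
  · intro h; exact absurd (Finset.mem_range.2 (by omega)) h

lemma ThetaS_inj (hMI : MonomialIdeal n M) (hproper : 0 ∉ M) (k : ℕ) (x : FIdx n M k →₀ Rp K n)
    (h : ∀ S : Finset (Fin n), S.card = k + 1 → phiS (AA K M) S (ThetaS K M k x) = 0) : x = 0 := by
  by_contra hx
  have hne : x.support.Nonempty := Finsupp.support_nonempty_iff.2 hx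
  obtain ⟨p, hp, hpmax⟩ := Finset.exists_max_image x.support (fun q => q.1.1.degree) hne
  set u := p.1.1 with hu
  set N := p.1.2 with hN
  have hmin : IsMinGen n M u := p.2.1
  have hu0 : u ≠ 0 := fun e => hproper (e ▸ hmin.1)
  have hsn : u.support.Nonempty := Finsupp.support_nonempty_iff.2 hu0
  set t := u.support.max' hsn with ht
  have htu : t ∈ u.support := Finset.max'_mem _ _
  have hut : u t ≠ 0 := Finsupp.mem_support_iff.1 htu
  have hmax : ∀ j ∈ u.support, j ≤ t := fun j hj => Finset.le_max' _ j hj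
  have htN : ∀ s ∈ N, s < t := by
    intro s hs
    obtain ⟨t', ht', hst⟩ := p.2.2.2 s hs
    exact lt_of_lt_of_le hst (hmax t' ht')
  have hm : u - Finsupp.single t 1 ∉ M := by
    intro hmem
    have e := hmin.2 _ hmem tsub_le_self
    have := DFunLike.congr_fun e t
    simp at this
    omega
  obtain ⟨f, hf⟩ := exists_coef (K := K) M hMI hm
  have hcard : (insert t N).card = k + 1 := by
    rw [Finset.card_insert_of_notMem (fun hh => lt_irrefl _ (htN t hh)), p.2.2.1]
  have h1 := h (insert t N) hcard
  set L : BB K M →ₗ[Rp K n] Rp K n :=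
    f ∘ₗ ((phiS (AA K M) (insert t N)).restrictScalars (Rp K n)) with hL
  have hL0 : L (ThetaS K M k x) = 0 := by
    change f (phiS (AA K M) (insert t N) (ThetaS K M k x)) = 0
    rw [h1, map_zero]
  have hLpsi : ∀ v T, L (psi K M v T) = if T = N then f (DD K M t v) else 0 := by
    intro v T
    change f (phiS (AA K M) (insert t N) (psi K M v T)) = _
    rw [phi_psi_max M htN]
    split_ifs
    · rfl
    · exact map_zero f
  rw [ThetaS, Finsupp.lift_apply, Finsupp.sum, map_sum, Finset.sum_eq_single p] at hL0
  · rw [map_smul, map_smul, hLpsi, if_pos rfl, f_DD_self M f hut hmax hf] at hL0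
    simp only [smul_eq_mul, mul_one] at hL0
    rcases mul_eq_zero.1 hL0 with h | h
    · exact Finsupp.mem_support_iff.1 hp h
    · exact absurd h (pow_ne_zero _ (by simp))
  · intro q hq hqp
    rw [map_smul, map_smul, hLpsi]
    split_ifs with hqN
    · rw [f_DD_other M f hut hf (hpmax q hq), smul_zero, smul_zero]
      intro e
      exact hqp (Subtype.ext (Prod.ext e hqN))
    · rw [smul_zero, smul_zero]
  · intro h; exact absurd hp h

lemma alg_inj (hMI : MonomialIdeal n M) (hproper : 0 ∉ M) (r : Rp K n)
    (h : phiS (AA K M) ∅ (algebraMap (Rp K n) (BB K M) r) = 0) : r = 0 := by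
  obtain ⟨f, hf⟩ := exists_coef (K := K) M hMI hproper
  rw [IsScalarTower.algebraMap_apply (Rp K n) (AA K M) (BB K M), Algebra.algebraMap_eq_smul_one,
    map_smul, ← ES_empty, phiS_ES, if_pos rfl, smul_eq_mul, mul_one] at h
  have h2 := hf 0
  rw [mp_zero, if_pos rfl] at h2
  have : f (r • (1 : AA K M)) = r := by rw [map_smul, h2, smul_eq_mul, mul_one]
  rw [← this, ← Algebra.algebraMap_eq_smul_one, h, map_zero]

lemma Theta_inj (hMI : MonomialIdeal n M) (hproper : 0 ∉ M) (k : ℕ) (x : FImod K n M k)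
    (h : ∀ S : Finset (Fin n), S.card = k → phiS (AA K M) S (Theta K M k x) = 0) : x = 0 := by
  match k, x, h with
  | 0, x, h => exact alg_inj M hMI hproper x (h ∅ rfl)
  | k+1, x, h => exact ThetaS_inj M hMI hproper k x h

lemma phi_ThetaS_card (k : ℕ) (x : FIdx n M k →₀ Rp K n) {S : Finset (Fin n)}
    (h : S.card ≠ k + 1) : phiS (AA K M) S (ThetaS K M k x) = 0 := by
  induction x using Finsupp.induction_linear with
  | zero => simp
  | add x x' hx hx' => rw [map_add, map_add, hx, hx', add_zero]
  | single p r =>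
    rw [ThetaS_single, smul_smul, ← algebraMap_smul (AA K M), map_smul,
      phi_psi_card M (by rw [p.2.2.1]; exact h), smul_zero]

lemma phi_Theta_card (k : ℕ) (x : FImod K n M k) {S : Finset (Fin n)} (h : S.card ≠ k) :
    phiS (AA K M) S (Theta K M k x) = 0 := by
  match k, x, h with
  | 0, x, h =>
    change phiS (AA K M) S (algebraMap (Rp K n) (BB K M) (show Rp K n from x)) = 0
    generalize (show Rp K n from x) = r
    rw [IsScalarTower.algebraMap_apply (Rp K n) (AA K M) (BB K M), Algebra.algebraMap_eq_smul_one,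
      map_smul, ← ES_empty, phiS_ES, if_neg, smul_zero]
    rintro rfl
    exact h rfl
  | k+1, x, h => exact phi_ThetaS_card M k x h

end ChainPart

section FinalPart

variable {K : Type} [Field K] {n : ℕ} (M : Set (Fin n →₀ ℕ))

def ThetaT (K : Type) [Field K] {n : ℕ} (M : Set (Fin n →₀ ℕ)) : FITot K n M →ₗ[Rp K n] BB K M :=
  DirectSum.toModule (Rp K n) ℕ (BB K M) (Theta K M)

lemma ThetaT_lof (k : ℕ) (x : FImod K n M k) : ThetaT K M (lofF K n M k x) = Theta K M k x :=
  DirectSum.toModule_lof (Rp K n) k x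

lemma DFI_lof (k : ℕ) (x : FImod K n M k) : DFI K n M (lofF K n M k x) = dFIcomp K n M k x :=
  DirectSum.toModule_lof (Rp K n) k x

lemma FITot_ind {P : FITot K n M → Prop} (h0 : P 0) (hl : ∀ k x, P (lofF K n M k x))
    (ha : ∀ x y, P x → P y → P (x + y)) (x : FITot K n M) : P x :=
  DirectSum.induction_on (motive := P) x h0 hl ha

lemma ThetaT_d (hMI : MonomialIdeal n M) (hB : BorelFixed n M) (x : FITot K n M) :
    ThetaT K M (DFI K n M x) = kosz (wv K M) (ThetaT K M x) := by
  induction x using FITot_ind M with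
  | h0 => simp
  | ha x y hx hy => rw [map_add, map_add, map_add, map_add, hx, hy]
  | hl k x =>
    rw [DFI_lof, ThetaT_lof]
    match k, x with
    | 0, x =>
      change ThetaT K M 0 = kosz (wv K M) (algebraMap (Rp K n) (BB K M) (show Rp K n from x))
      rw [Algebra.algebraMap_eq_smul_one, kosz_smul_R, kosz_one, smul_zero, map_zero]
    | k+1, x => exact (ThetaT_lof M k _).trans (Theta_d M hMI hB k x)

lemma phi_ThetaT (S : Finset (Fin n)) (x : FITot K n M) : phiS (AA K M) S (ThetaT K M x) =
    phiS (AA K M) S (Theta K M S.card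
      (DirectSum.component (Rp K n) ℕ (FImod K n M) S.card x)) := by
  induction x using FITot_ind M with
  | h0 => rw [map_zero]; exact (congrArg _ (map_zero (Theta K M S.card))).symm
  | ha x y hx hy =>
    rw [map_add, map_add, hx, hy, ← map_add, ← map_add]
    congr 2
  | hl k x =>
    rw [ThetaT_lof]
    by_cases h : S.card = k
    · subst h
      congr 2
      exact (DirectSum.component.lof_self (Rp K n) _ x).symm
    · rw [phi_Theta_card M k x h]
      have : DirectSum.component (Rp K n) ℕ (FImod K n M) S.card (lofF K n M k x) = 0 := by
        refine (DirectSum.component.of (Rp K n) _ _ x).trans ?_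
        rw [dif_neg (fun e => h e.symm)]
      rw [this, map_zero, map_zero]

lemma ThetaT_inj (hMI : MonomialIdeal n M) (hproper : 0 ∉ M) :
    Function.Injective (ThetaT K M) := by
  rw [injective_iff_map_eq_zero]
  intro x hx
  refine DirectSum.ext_component (Rp K n) (fun k => ?_)
  refine Eq.trans ?_ (map_zero (DirectSum.component (Rp K n) ℕ (FImod K n M) k)).symm
  apply Theta_inj M hMI hproper
  intro S hS
  subst hS
  rw [← phi_ThetaT, hx, map_zero]

lemma ThetaT_mul (hMI : MonomialIdeal n M) (hB : BorelFixed n M) (x y : FITot K n M) :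
    ∃ z, ThetaT K M z = ThetaT K M x * ThetaT K M y := by
  induction x using FITot_ind M with
  | h0 => exact ⟨0, by simp⟩
  | ha x x' hx hx' =>
    obtain ⟨z, hz⟩ := hx
    obtain ⟨z', hz'⟩ := hx'
    exact ⟨z + z', by rw [map_add, map_add, add_mul, hz, hz']⟩
  | hl i x =>
    induction y using FITot_ind M with
    | h0 => exact ⟨0, by simp⟩
    | ha y y' hx hx' =>
      obtain ⟨z, hz⟩ := hx
      obtain ⟨z', hz'⟩ := hx'
      exact ⟨z + z', by rw [map_add, map_add, mul_add, hz, hz']⟩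
    | hl j y =>
      obtain ⟨z, hz⟩ := Theta_mul M hMI hB i j x y
      exact ⟨lofF K n M (i + j) z, by rw [ThetaT_lof, ThetaT_lof, ThetaT_lof, hz]⟩

lemma exists_mul {R F B : Type} [CommRing R] [AddCommGroup F] [Module R F] [Ring B] [Algebra R B]
    (T : F →ₗ[R] B) (hT : Function.Injective T) (hm : ∀ x y, ∃ z, T z = T x * T y) :
    ∃ mul : F →ₗ[R] F →ₗ[R] F, ∀ x y, T (mul x y) = T x * T y := by
  choose g hg using hm
  refine ⟨LinearMap.mk₂ R g ?_ ?_ ?_ ?_, fun x y => hg x y⟩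
  · intro a b c; apply hT; rw [hg, map_add, map_add, hg, hg, add_mul]
  · intro r a b; apply hT; rw [hg, map_smul, map_smul, hg, smul_mul_assoc]
  · intro a b c; apply hT; rw [hg, map_add, map_add, hg, hg, mul_add]
  · intro r a b; apply hT; rw [hg, map_smul, map_smul, hg, mul_smul_comm]

lemma ThetaT_one : ThetaT K M (lofF K n M 0 (1 : Rp K n)) = 1 :=
  (ThetaT_lof M 0 _).trans (map_one (algebraMap (Rp K n) (BB K M)))

end FinalPart

/-- Let `I ⊆ R` be a (proper) Borel-fixed monomial ideal, given by
its set `M` of exponent vectors.  Then the Eliahou–Kervaire minimal free resolution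
`F_I` of `R/I` admits the structure of a graded-commutative, associative DG algebra:
there exists a unitary, associative multiplication on `F_I` with
`F_i · F_j ⊆ F_{i+j}`, satisfying the Leibniz rule with respect to the differential
`d = ∂ - μ` of `F_I`, graded commutativity, and squaring to zero in odd degrees. -/
theorem EK_resolution_admits_DG_algebra (hn : 1 ≤ n) (M : Set (Fin n →₀ ℕ))
    (hMI : MonomialIdeal n M) (hB : BorelFixed n M) (hproper : 0 ∉ M) :
    ∃ mul : FITot K n M →ₗ[Rp K n] FITot K n M →ₗ[Rp K n] FITot K n M,
      -- grading: Fᵢ · Fⱼ ⊆ F_{i+j}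
      (∀ i j (x : FImod K n M i) (y : FImod K n M j),
        ∃ z : FImod K n M (i+j),
          mul (lofF K n M i x) (lofF K n M j y) = lofF K n M (i+j) z) ∧
      -- unitary, with unit 1 ∈ R = degree-0 component
      (∀ x, mul (lofF K n M 0 (1 : Rp K n)) x = x) ∧
      (∀ x, mul x (lofF K n M 0 (1 : Rp K n)) = x) ∧
      -- associative
      (∀ x y z, mul (mul x y) z = mul x (mul y z)) ∧
      -- graded-commutative
      (∀ i j (x : FImod K n M i) (y : FImod K n M j),
        mul (lofF K n M i x) (lofF K n M j y) =
          ((-1 : Rp K n) ^ (i * j)) • mul (lofF K n M j y) (lofF K n M i x)) ∧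
      -- odd-degree elements square to zero
      (∀ i, Odd i → ∀ x : FImod K n M i,
        mul (lofF K n M i x) (lofF K n M i x) = 0) ∧
      -- Leibniz rule with respect to the differential of F_I
      (∀ i j (x : FImod K n M i) (y : FImod K n M j),
        DFI K n M (mul (lofF K n M i x) (lofF K n M j y)) =
          mul (DFI K n M (lofF K n M i x)) (lofF K n M j y) +
            ((-1 : Rp K n) ^ i) • mul (lofF K n M i x) (DFI K n M (lofF K n M j y))) := by
  have hinj := ThetaT_inj (K := K) M hMI hproper
  obtain ⟨mul, hmul⟩ := exists_mul (ThetaT K M) hinj (ThetaT_mul M hMI hB)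
  have hg : ∀ i (x : FImod K n M i),
      ThetaT K M (lofF K n M i x) ∈ ⋀[AA K M]^i (Fin n → AA K M) := by
    intro i x
    rw [ThetaT_lof]
    exact Theta_grade M i x
  refine ⟨mul, ?_, ?_, ?_, ?_, ?_, ?_, ?_⟩
  · intro i j x y
    obtain ⟨z, hz⟩ := Theta_mul M hMI hB i j x y
    refine ⟨z, hinj ?_⟩
    rw [hmul, ThetaT_lof, ThetaT_lof, ThetaT_lof, hz]
  · intro x
    apply hinj
    rw [hmul, ThetaT_one, one_mul]
  · intro x
    apply hinj
    rw [hmul, ThetaT_one, mul_one]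
  · intro x y z
    apply hinj
    rw [hmul, hmul, hmul, hmul, mul_assoc]
  · intro i j x y
    apply hinj
    rw [map_smul, hmul, hmul, ext_comm i j _ _ (hg i x) (hg j y), neg_smul_AA]
  · intro i hi x
    apply hinj
    rw [hmul, map_zero, ext_sq i hi _ (hg i x)]
  · intro i j x y
    apply hinj
    rw [map_add, map_smul, ThetaT_d M hMI hB, hmul, hmul, hmul, ThetaT_d M hMI hB,
      ThetaT_d M hMI hB, kosz_leibniz _ i _ _ (hg i x), neg_smul_AA]

end
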